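/- Let M be a connected even-dimensional manifold of finite type such that every unordered configuration space C_k(M) has finite-dimensional rational cohomology. (1) If M satisfies the Poincaré-polynomial shifted stability condition with range r, shift σ and some ratio R(t) ≠ 0, then M satisfies the extended shifted stability condition with shift σ and some range r' ≥ r. (2) If M satisfies the extended shifted stability condition with range r and shift σ, then M satisfies the shifted stability condition with range r, shift σ and every length q with 1 ≤ q ≤ σ. -/

import Mathlib

open CategoryTheory

/-- The singular chain complex of a topological space with rational coefficients:
the alternating face map complex of the free simplicial `ℚ`-module on the singular
simplicial set. -/
noncomputable def singularChainComplexQ (X : Type) [TopologicalSpace X] :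
    ChainComplex (ModuleCat ℚ) ℕ :=
  (AlgebraicTopology.alternatingFaceMapComplex (ModuleCat ℚ)).obj
    (((CategoryTheory.SimplicialObject.whiskering _ _).obj (ModuleCat.free ℚ)).obj
      (TopCat.toSSet.obj (TopCat.of X)))

/-- Singular homology with rational coefficients. -/
noncomputable def singularHomologyQ (X : Type) [TopologicalSpace X] (n : ℕ) : ModuleCat ℚ :=
  (singularChainComplexQ X).homology n

/-- Singular cohomology with rational coefficients.  Since `ℚ` is a field, by the universal
coefficient theorem `H^n(X;ℚ)` is naturally isomorphic to the linear dual of `H_n(X;ℚ)`,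
which we take as the definition. -/
noncomputable def singularCohomologyQ (X : Type) [TopologicalSpace X] (n : ℕ) : Type :=
  Module.Dual ℚ (singularHomologyQ X n)

noncomputable instance (X : Type) [TopologicalSpace X] (n : ℕ) :
    AddCommGroup (singularCohomologyQ X n) :=
  inferInstanceAs (AddCommGroup (Module.Dual ℚ (singularHomologyQ X n)))

noncomputable instance (X : Type) [TopologicalSpace X] (n : ℕ) :
    Module ℚ (singularCohomologyQ X n) :=
  inferInstanceAs (Module ℚ (Module.Dual ℚ (singularHomologyQ X n)))

/-- The `i`-th rational Betti number `β_i(X) = dim_ℚ H^i(X;ℚ)`. -/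
noncomputable def bettiQ (X : Type) [TopologicalSpace X] (i : ℕ) : ℕ :=
  Module.finrank ℚ (singularCohomologyQ X i)

/-- The ordered configuration space `F_k(X)` of `k` distinct points of `X`,
with the subspace topology from `X^k`. -/
def orderedConfig (X : Type) [TopologicalSpace X] (k : ℕ) : Type :=
  {f : Fin k → X // Function.Injective f}

instance (X : Type) [TopologicalSpace X] (k : ℕ) : TopologicalSpace (orderedConfig X k) :=
  inferInstanceAs (TopologicalSpace {f : Fin k → X // Function.Injective f})

/-- The unordered configuration space `C_k(X) = F_k(X)/S_k`, the quotient of the ordered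
configuration space by the permutation action of the symmetric group, with the quotient
topology. -/
def unorderedConfig (X : Type) [TopologicalSpace X] (k : ℕ) : Type :=
  Quot (fun f g : orderedConfig X k => ∃ σ : Equiv.Perm (Fin k), g.1 = f.1 ∘ σ)

instance (X : Type) [TopologicalSpace X] (k : ℕ) : TopologicalSpace (unorderedConfig X k) :=
  inferInstanceAs (TopologicalSpace (Quot _))

/-- `M` has the strong stability property with range `r`:
`H^i(C_k(M);ℚ) ≅ H^i(C_{k+1}(M);ℚ)` for all `i ≥ 0` and all `k ≥ r`. -/
def StrongStabilityRange (M : Type) [TopologicalSpace M] (r : ℕ) : Prop :=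
  ∀ k : ℕ, r ≤ k → ∀ i : ℕ,
    Nonempty (singularCohomologyQ (unorderedConfig M k) i ≃ₗ[ℚ]
      singularCohomologyQ (unorderedConfig M (k + 1)) i)

/-- `M` has the strong stability property: for some `r ≥ 1`, the rational cohomology of its
unordered configuration spaces is constant from `C_r(M)` on. -/
def StrongStability (M : Type) [TopologicalSpace M] : Prop :=
  ∃ r : ℕ, 1 ≤ r ∧ StrongStabilityRange M r

/-- `X` has finite-dimensional total rational cohomology: each `H^i(X;ℚ)` is
finite-dimensional and all but finitely many vanish. -/
def FiniteTotalCohomologyQ (X : Type) [TopologicalSpace X] : Prop :=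
  (∀ i : ℕ, FiniteDimensional ℚ (singularCohomologyQ X i)) ∧
  ∃ N : ℕ, ∀ i : ℕ, N ≤ i → Subsingleton (singularCohomologyQ X i)

/-- `M` is a rational homology `n`-sphere: `H^*(M;ℚ) ≅ H^*(S^n;ℚ)`, i.e.
`H^i(M;ℚ)` is one-dimensional for `i ∈ {0, n}` and vanishes otherwise (`n ≥ 1`). -/
def RatHomologySphere (M : Type) [TopologicalSpace M] (n : ℕ) : Prop :=
  ∀ i : ℕ, Module.rank ℚ (singularCohomologyQ M i) = if i = 0 ∨ i = n then 1 else 0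

/-- `M` (of dimension `4m`) is a homology projective plane:
`β_0 = β_{2m} = β_{4m} = 1` and all other Betti numbers vanish. -/
def HomologyProjPlane (M : Type) [TopologicalSpace M] (m : ℕ) : Prop :=
  ∀ i : ℕ, bettiQ M i = if i = 0 ∨ i = 2 * m ∨ i = 4 * m then 1 else 0

/-- The rational cohomological dimension: the largest `i` with `H^i(X;ℚ) ≠ 0`. -/
noncomputable def cohomDimQ (X : Type) [TopologicalSpace X] : ℕ :=
  sSup {i : ℕ | bettiQ X i ≠ 0}

/-- The `q`-truncated Poincaré polynomial
`P^{[q]}_X(t) = β_{τ-q+1} t^{τ-q+1} + ⋯ + β_τ t^τ` where `τ = cd(X)`. -/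
noncomputable def truncPoincareQ (X : Type) [TopologicalSpace X] (q : ℕ) : Polynomial ℕ :=
  ∑ j ∈ Finset.range q,
    if j ≤ cohomDimQ X then
      Polynomial.monomial (cohomDimQ X - j) (bettiQ X (cohomDimQ X - j))
    else 0

/-- The Poincaré polynomial `P_X(t) = ∑ᵢ β_i(X) tⁱ` (of a space with finite-dimensional
total cohomology). -/
noncomputable def poincarePolyQ (X : Type) [TopologicalSpace X] : Polynomial ℕ :=
  ∑ i ∈ Finset.range (cohomDimQ X + 1), Polynomial.monomial i (bettiQ X i)

/-- `M` satisfies the shifted stability condition with range `r`, shift `σ` and length `q`: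
`P^{[q]}_{C_{k+1}(M)}(t) = t^σ P^{[q]}_{C_k(M)}(t)` for all `k ≥ r`. -/
def ShiftedStabilityQ (M : Type) [TopologicalSpace M] (r σ q : ℕ) : Prop :=
  ∀ k : ℕ, r ≤ k →
    truncPoincareQ (unorderedConfig M (k + 1)) q =
      Polynomial.X ^ σ * truncPoincareQ (unorderedConfig M k) q

/-- `M` satisfies the Poincaré-polynomial shifted stability condition with range `r`,
shift `σ` and ratio `R`:  `P_{C_{k+1}(M)}(t) = P_{C_k(M)}(t) + t^{(k+1-r)σ} R(t)` for all
`k ≥ r`. -/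
def PoincarePolyShiftedStability (M : Type) [TopologicalSpace M] (r σ : ℕ)
    (R : Polynomial ℕ) : Prop :=
  ∀ k : ℕ, r ≤ k →
    poincarePolyQ (unorderedConfig M (k + 1)) =
      poincarePolyQ (unorderedConfig M k) + Polynomial.X ^ ((k + 1 - r) * σ) * R

/-- `M` satisfies the extended shifted stability condition with range `r` and shift `σ`:
`P^{[(k-r+1)σ]}_{C_{k+1}(M)}(t) = t^σ P^{[(k-r+1)σ]}_{C_k(M)}(t)` for all `k ≥ r`. -/
def ExtendedShiftedStability (M : Type) [TopologicalSpace M] (r σ : ℕ) : Prop :=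
  ∀ k : ℕ, r ≤ k →
    truncPoincareQ (unorderedConfig M (k + 1)) ((k - r + 1) * σ) =
      Polynomial.X ^ σ * truncPoincareQ (unorderedConfig M k) ((k - r + 1) * σ)

section BettiNumbers

open Polynomial

variable {X Y : Type} [TopologicalSpace X] [TopologicalSpace Y]

theorem FiniteTotalCohomologyQ.bddAbove (h : FiniteTotalCohomologyQ X) :
    BddAbove {i : ℕ | bettiQ X i ≠ 0} := by
  obtain ⟨N, hN⟩ := h.2
  refine ⟨N, fun i hi => ?_⟩
  by_contra hlt
  have := hN i (by omega)
  exact hi Module.finrank_zero_of_subsingleton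

theorem FiniteTotalCohomologyQ.le_cohomDimQ (h : FiniteTotalCohomologyQ X) {i : ℕ}
    (hi : bettiQ X i ≠ 0) : i ≤ cohomDimQ X :=
  le_csSup h.bddAbove hi

theorem FiniteTotalCohomologyQ.bettiQ_cohomDimQ_ne_zero (h : FiniteTotalCohomologyQ X) {i : ℕ}
    (hi : bettiQ X i ≠ 0) : bettiQ X (cohomDimQ X) ≠ 0 :=
  Nat.sSup_mem (s := {i : ℕ | bettiQ X i ≠ 0}) ⟨i, hi⟩ h.bddAbove

theorem FiniteTotalCohomologyQ.coeff_poincarePolyQ (h : FiniteTotalCohomologyQ X) (i : ℕ) :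
    (poincarePolyQ X).coeff i = bettiQ X i := by
  simp only [poincarePolyQ, finsetSum_coeff, coeff_monomial, Finset.sum_ite_eq',
    Finset.mem_range]
  split_ifs with hi
  · rfl
  · by_contra hne
    have := h.le_cohomDimQ (Ne.symm hne)
    omega

theorem FiniteTotalCohomologyQ.natDegree_poincarePolyQ (h : FiniteTotalCohomologyQ X) :
    (poincarePolyQ X).natDegree = cohomDimQ X := by
  by_cases h0 : ∃ i, bettiQ X i ≠ 0
  · obtain ⟨i, hi⟩ := h0
    refine natDegree_eq_of_le_of_coeff_ne_zero ?_ ?_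
    · refine natDegree_le_iff_coeff_eq_zero.2 fun j hj => ?_
      rw [h.coeff_poincarePolyQ]
      by_contra hne
      have := h.le_cohomDimQ hne
      omega
    · rw [h.coeff_poincarePolyQ]
      exact h.bettiQ_cohomDimQ_ne_zero hi
  · push Not at h0
    simp [poincarePolyQ, cohomDimQ, h0]

theorem coeff_truncPoincareQ (q i : ℕ) :
    (truncPoincareQ X q).coeff i =
      if i ≤ cohomDimQ X ∧ cohomDimQ X < i + q then bettiQ X i else 0 := by
  have hterm : ∀ j ∈ Finset.range q,
      (if j ≤ cohomDimQ X then
        monomial (cohomDimQ X - j) (bettiQ X (cohomDimQ X - j)) else 0 : ℕ[X]).coeff i =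
      if cohomDimQ X - i = j then (if i ≤ cohomDimQ X then bettiQ X i else 0) else 0 := by
    intro j _
    by_cases hj : j ≤ cohomDimQ X
    · rw [if_pos hj, coeff_monomial]
      split_ifs with h1 h2 h3 h4 h5
      · rw [h1]
      all_goals first | rfl | omega
    · rw [if_neg hj, coeff_zero]
      split_ifs <;> first | rfl | omega
  rw [truncPoincareQ, finsetSum_coeff, Finset.sum_congr rfl hterm, Finset.sum_ite_eq]
  simp only [Finset.mem_range]
  split_ifs <;> first | rfl | omega

/-- A shift relation between nonempty truncations determines the shift of the top degree,
unless the cohomology of both spaces vanishes. -/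
theorem cohomDimQ_eq_add_of_truncPoincareQ_eq (hX : FiniteTotalCohomologyQ X)
    (hY : FiniteTotalCohomologyQ Y) {σ q : ℕ} (hq : 1 ≤ q)
    (h : truncPoincareQ Y q = Polynomial.X ^ σ * truncPoincareQ X q) :
    ((∀ i, bettiQ X i = 0) ∧ ∀ i, bettiQ Y i = 0) ∨ cohomDimQ Y = cohomDimQ X + σ := by
  have hc (i : ℕ) := congrArg (fun p => p.coeff i) h
  simp only [coeff_X_pow_mul', coeff_truncPoincareQ] at hc
  have htopX : (∃ i, bettiQ X i ≠ 0) →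
      bettiQ Y (cohomDimQ X + σ) ≠ 0 := by
    rintro ⟨i, hi⟩ hzero
    have h1 := hX.bettiQ_cohomDimQ_ne_zero hi
    have h2 := hc (cohomDimQ X + σ)
    rw [if_pos (by omega : σ ≤ cohomDimQ X + σ), Nat.add_sub_cancel, hzero, ite_self,
      if_pos ⟨le_rfl, by omega⟩] at h2
    exact h1 h2.symm
  have htopY : (∃ i, bettiQ Y i ≠ 0) →
      σ ≤ cohomDimQ Y ∧ cohomDimQ Y - σ ≤ cohomDimQ X ∧ ∃ i, bettiQ X i ≠ 0 := by
    rintro ⟨i, hi⟩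
    have h1 := hY.bettiQ_cohomDimQ_ne_zero hi
    have h2 := hc (cohomDimQ Y)
    rw [if_pos (by omega)] at h2
    split_ifs at h2 with h3 h4
    · exact ⟨h3, h4.1, _, h2 ▸ h1⟩
    all_goals exact absurd h2 h1
  by_cases hex : ∃ i, bettiQ X i ≠ 0
  · right
    have h1 := htopX hex
    have h2 := hY.le_cohomDimQ h1
    have h3 := htopY ⟨_, h1⟩
    omega
  · left
    refine ⟨by simpa using hex, fun i => ?_⟩
    by_contra hne
    exact hex (htopY ⟨i, hne⟩).2.2

theorem truncPoincareQ_eq_of_le (hX : FiniteTotalCohomologyQ X)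
    (hY : FiniteTotalCohomologyQ Y) {σ q q' : ℕ} (hq : 1 ≤ q) (hqq' : q ≤ q')
    (h : truncPoincareQ Y q' = Polynomial.X ^ σ * truncPoincareQ X q') :
    truncPoincareQ Y q = Polynomial.X ^ σ * truncPoincareQ X q := by
  ext i
  rcases cohomDimQ_eq_add_of_truncPoincareQ_eq hX hY (hq.trans hqq') h with ⟨h1, h2⟩ | hdim
  · simp [coeff_X_pow_mul', coeff_truncPoincareQ, h1, h2]
  · have hc := congrArg (fun p => p.coeff i) h
    simp only [coeff_X_pow_mul', coeff_truncPoincareQ, hdim] at hc ⊢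
    split_ifs at hc ⊢ <;> first | rfl | exact hc | omega

end BettiNumbers

section PolynomialRecurrence

open Polynomial

variable {P : ℕ → ℕ[X]} {R : ℕ[X]} {σ : ℕ}

theorem natDegree_le_of_shifted_recurrence
    (hP : ∀ n, P (n + 1) = P n + X ^ ((n + 1) * σ) * R) (n : ℕ) :
    (P n).natDegree ≤ max (P 0).natDegree (n * σ + R.natDegree) := by
  induction n with
  | zero => exact le_max_left _ _
  | succ n ih =>
    rw [hP]
    have h1 := natDegree_add_le (P n) (X ^ ((n + 1) * σ) * R)
    have h2 : (X ^ ((n + 1) * σ) * R : ℕ[X]).natDegree ≤ (n + 1) * σ + R.natDegree :=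
      natDegree_mul_le.trans (by rw [natDegree_X_pow])
    have h3 : n * σ ≤ (n + 1) * σ := Nat.mul_le_mul_right _ n.le_succ
    omega

theorem natDegree_eq_of_shifted_recurrence (hR : R ≠ 0) (hσ : 1 ≤ σ)
    (hP : ∀ n, P (n + 1) = P n + X ^ ((n + 1) * σ) * R) {n : ℕ}
    (hn : (P 0).natDegree < n) :
    (P n).natDegree = n * σ + R.natDegree := by
  obtain ⟨n, rfl⟩ : ∃ l, n = l + 1 := ⟨n - 1, by omega⟩
  have h1 := natDegree_le_of_shifted_recurrence hP n
  have h2 : (X ^ ((n + 1) * σ) * R : ℕ[X]).natDegree = (n + 1) * σ + R.natDegree := by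
    rw [natDegree_mul (pow_ne_zero _ X_ne_zero) hR, natDegree_X_pow]
  have h3 : (n + 1) * σ = n * σ + σ := Nat.succ_mul _ _
  have h4 : n + 1 ≤ (n + 1) * σ := Nat.le_mul_of_pos_right _ hσ
  rw [hP, natDegree_add_eq_right_of_natDegree_lt (by omega), h2]

theorem coeff_add_shift_of_shifted_recurrence
    (hP : ∀ n, P (n + 1) = P n + X ^ ((n + 1) * σ) * R) (n : ℕ) {i : ℕ}
    (hi : (P 0).natDegree + R.natDegree < i) :
    (P (n + 1)).coeff (i + σ) = (P n).coeff i := by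
  induction n with
  | zero =>
    have h1 : (P 0).coeff (i + σ) = 0 := coeff_eq_zero_of_natDegree_lt (by omega)
    have h2 : (P 0).coeff i = 0 := coeff_eq_zero_of_natDegree_lt (by omega)
    have h3 : R.coeff i = 0 := coeff_eq_zero_of_natDegree_lt (by omega)
    rw [hP, zero_add, one_mul, coeff_add, coeff_X_pow_mul, h1, h2, h3]
  | succ n ih =>
    rw [hP (n + 1), coeff_add, ih, hP n, coeff_add, Nat.succ_mul (n + 1), pow_add,
      mul_comm (X ^ _) (X ^ σ), mul_assoc, coeff_X_pow_mul]

end PolynomialRecurrence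

/-- Let `M` be a connected even-dimensional manifold of finite type such
that every unordered configuration space `C_k(M)` has finite-dimensional total rational
cohomology.  (1) If `M` satisfies the Poincaré-polynomial shifted stability condition with
range `r`, shift `σ` and some nonzero ratio `R`, then `M` satisfies the extended shifted
stability condition with shift `σ` and some range `r' ≥ r`.  (2) If `M` satisfies the
extended shifted stability condition with range `r` and shift `σ`, then `M` satisfies the
shifted stability condition with range `r`, shift `σ` and every length `q` with
`1 ≤ q ≤ σ`. -/
theorem shifted_stability_implications (m : ℕ) (M : Type) [TopologicalSpace M]
    [ChartedSpace (EuclideanSpace ℝ (Fin (2 * m))) M]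
    [T2Space M] [SecondCountableTopology M] [ConnectedSpace M]
    (hfinM : FiniteTotalCohomologyQ M)
    (hfin : ∀ k : ℕ, FiniteTotalCohomologyQ (unorderedConfig M k)) :
    (∀ r σ : ℕ, 1 ≤ r → 1 ≤ σ → ∀ R : Polynomial ℕ, R ≠ 0 →
      PoincarePolyShiftedStability M r σ R →
        ∃ r' : ℕ, r ≤ r' ∧ ExtendedShiftedStability M r' σ) ∧
    (∀ r σ : ℕ, 1 ≤ r → 1 ≤ σ → ExtendedShiftedStability M r σ →
      ∀ q : ℕ, 1 ≤ q → q ≤ σ → ShiftedStabilityQ M r σ q) := by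
  refine ⟨fun r σ hr hσ R hR h => ?_, fun r σ hr hσ h q hq hqσ k hk => ?_⟩
  · let P : ℕ → Polynomial ℕ := fun n => poincarePolyQ (unorderedConfig M (r + n))
    have hP : ∀ n, P (n + 1) = P n + Polynomial.X ^ ((n + 1) * σ) * R := by
      intro n
      have := h (r + n) (Nat.le_add_right _ _)
      rwa [show r + n + 1 - r = n + 1 by omega] at this
    set A := (P 0).natDegree + R.natDegree with hA
    refine ⟨r + (A + 1), Nat.le_add_right _ _, fun k hk => ?_⟩
    obtain ⟨s, rfl⟩ := Nat.exists_eq_add_of_le hk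
    have hdim : ∀ n, (P 0).natDegree < n →
        cohomDimQ (unorderedConfig M (r + n)) = n * σ + R.natDegree := fun n hn => by
      rw [← (hfin (r + n)).natDegree_poincarePolyQ]
      exact natDegree_eq_of_shifted_recurrence hR hσ hP hn
    have hbetti : ∀ i, A < i → bettiQ (unorderedConfig M (r + (A + 1 + s + 1))) (i + σ) =
        bettiQ (unorderedConfig M (r + (A + 1 + s))) i := fun i hi => by
      rw [← (hfin _).coeff_poincarePolyQ, ← (hfin _).coeff_poincarePolyQ]
      exact coeff_add_shift_of_shifted_recurrence hP (A + 1 + s) hi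
    have hd := hdim (A + 1 + s) (by omega)
    have hd' := hdim (A + 1 + s + 1) (by omega)
    rw [show r + (A + 1) + s - (r + (A + 1)) + 1 = s + 1 by omega,
      show r + (A + 1) + s = r + (A + 1 + s) by omega]
    ext i
    rw [Polynomial.coeff_X_pow_mul', coeff_truncPoincareQ, coeff_truncPoincareQ, add_assoc r,
      hd, hd']
    have hAσ : A ≤ A * σ := Nat.le_mul_of_pos_right _ hσ
    simp only [Nat.add_mul, one_mul]
    by_cases hi : σ ≤ i
    · obtain ⟨j, rfl⟩ := Nat.exists_eq_add_of_le' hi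
      rw [if_pos hi, Nat.add_sub_cancel]
      split_ifs with h1 h2 h3
      · exact hbetti j (by omega)
      all_goals first | rfl | omega
    · rw [if_neg hi, if_neg (by omega)]
  · exact truncPoincareQ_eq_of_le (hfin k) (hfin (k + 1)) hq
      (hqσ.trans (Nat.le_mul_of_pos_left _ (Nat.succ_pos _))) (h k hk)
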